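/- If R is a commutative ring (domain) that is not a Prüfer domain, then there exists a graph G with edge labeling α over R that does not satisfy the Universal Difference Property. Specifically, if I, J, K are nonzero ideals with I + (J ∩ K) ≠ (I + J) ∩ (I + K), then the graph formed by pasting two 4-cycles at a vertex z — with all edges of the first cycle labeled I, one z–w path in the second cycle labeled J on each edge, and the other labeled K on each edge — fails UDP for the vertices u (opposite z in the first cycle) and w (opposite z in the second cycle). -/

import Mathlib

open SimpleGraph

/-- A generalized spline on an edge labeled graph. -/
def IsSpline {V R : Type*} [CommRing R] (G : SimpleGraph V)
    (α : Sym2 V → Ideal R) (ρ : V → R) : Prop :=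
  ∀ u v : V, G.Adj u v → ρ u - ρ v ∈ α s(u, v)

/-- The sum of the ideals labeling the edges of a walk. -/
def walkIdealSum {V R : Type*} [CommRing R] (G : SimpleGraph V)
    (α : Sym2 V → Ideal R) {u w : V} (p : G.Walk u w) : Ideal R :=
  (p.edges.map α).sum

/-- The intersection of `α(P)` over all paths `P` from `u` to `w`. -/
def pathsInf {V R : Type*} [CommRing R] (G : SimpleGraph V)
    (α : Sym2 V → Ideal R) (u w : V) : Ideal R :=
  ⨅ (p : G.Walk u w) (_ : p.IsPath), walkIdealSum G α p

/-- The Universal Difference Property. -/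
def UDP {V R : Type*} [CommRing R] (G : SimpleGraph V)
    (α : Sym2 V → Ideal R) : Prop :=
  ∀ u w : V, G.Reachable u w → ∀ x ∈ pathsInf G α u w,
    ∃ ρ : V → R, IsSpline G α ρ ∧ ρ u - ρ w = x

/-- A Prüfer domain: every nonzero finitely generated ideal is invertible. -/
def IsPruferDomain (R : Type*) [CommRing R] [IsDomain R] : Prop :=
  ∀ I : Ideal R, I ≠ ⊥ → I.FG →
    IsUnit (I : FractionalIdeal (nonZeroDivisors R) (FractionRing R))

theorem le_walkIdealSum {V R : Type*} [CommRing R] {G : SimpleGraph V}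
    (α : Sym2 V → Ideal R) {u w : V} (p : G.Walk u w) {e : Sym2 V} (he : e ∈ p.edges) :
    α e ≤ walkIdealSum G α p := by
  have hmem : α e ∈ p.edges.map α := List.mem_map_of_mem he
  unfold walkIdealSum
  generalize p.edges.map α = l at hmem
  induction l with
  | nil => simp at hmem
  | cons a l ih =>
    rw [List.sum_cons, Submodule.add_eq_sup]
    rcases List.mem_cons.1 hmem with h | h
    · exact h ▸ le_sup_left
    · exact (ih h).trans le_sup_right

theorem exists_adj_mem_edges {V : Type*} {G : SimpleGraph V} {u w : V} (p : G.Walk u w)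
    (huw : u ≠ w) : ∃ v, G.Adj u v ∧ s(u, v) ∈ p.edges := by
  cases p with
  | nil => exact absurd rfl huw
  | cons h q => exact ⟨_, h, by simp⟩

/-- The edges of the two 4-cycles `0 1 2 3` and `0 4 5 6`, pasted at the vertex `0`. -/
def pastedCyclesEdges : Finset (Sym2 (Fin 7)) :=
  {s(0, 1), s(1, 2), s(2, 3), s(3, 0), s(0, 4), s(4, 5), s(0, 6), s(6, 5)}

/-- Two 4-cycles pasted at the vertex `0`. -/
def pastedCycles : SimpleGraph (Fin 7) where
  Adj u v := s(u, v) ∈ pastedCyclesEdges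
  symm := ⟨by decide⟩
  loopless := ⟨by decide⟩

instance : DecidableRel pastedCycles.Adj :=
  fun u v => inferInstanceAs (Decidable (s(u, v) ∈ pastedCyclesEdges))

/-- Edges of the first cycle are labeled `I`, those of the path `0 4 5` are labeled `J` and those
of the path `0 6 5` are labeled `K`. -/
def pastedCyclesLabel {R : Type*} [CommRing R] (I J K : Ideal R) (e : Sym2 (Fin 7)) : Ideal R :=
  if e = s(0, 4) ∨ e = s(4, 5) then J else if e = s(0, 6) ∨ e = s(6, 5) then K else I

theorem pastedCyclesLabel_of_adj_two {R : Type*} [CommRing R] (I J K : Ideal R) {v : Fin 7}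
    (hv : pastedCycles.Adj 2 v) : pastedCyclesLabel I J K s(2, v) = I := by
  have key : ∀ v : Fin 7, pastedCycles.Adj 2 v →
      ¬ (s(2, v) = s(0, 4) ∨ s(2, v) = s(4, 5)) ∧
        ¬ (s(2, v) = s(0, 6) ∨ s(2, v) = s(6, 5)) := by decide
  rw [pastedCyclesLabel, if_neg (key v hv).1, if_neg (key v hv).2]

theorem pastedCyclesLabel_of_adj_five {R : Type*} [CommRing R] (I J K : Ideal R) {v : Fin 7}
    (hv : pastedCycles.Adj 5 v) :
    pastedCyclesLabel I J K s(5, v) = J ∨ pastedCyclesLabel I J K s(5, v) = K := by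
  have key : ∀ v : Fin 7, pastedCycles.Adj 5 v →
      (s(5, v) = s(0, 4) ∨ s(5, v) = s(4, 5)) ∨
        (s(5, v) = s(0, 6) ∨ s(5, v) = s(6, 5)) := by decide
  unfold pastedCyclesLabel
  split_ifs with h₁ h₂
  · exact Or.inl rfl
  · exact Or.inr rfl
  · exact absurd (key v hv) (by tauto)

theorem inf_sup_le_pathsInf {R : Type*} [CommRing R] (I J K : Ideal R) :
    (I ⊔ J) ⊓ (I ⊔ K) ≤ pathsInf pastedCycles (pastedCyclesLabel I J K) 2 5 := by
  refine le_iInf fun p => le_iInf fun _ => ?_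
  obtain ⟨v, hv, hvp⟩ := exists_adj_mem_edges p (by decide)
  obtain ⟨v', hv', hvp'⟩ := exists_adj_mem_edges p.reverse (by decide)
  rw [Walk.edges_reverse, List.mem_reverse] at hvp'
  have hI := le_walkIdealSum (pastedCyclesLabel I J K) p hvp
  have hJK := le_walkIdealSum (pastedCyclesLabel I J K) p hvp'
  rw [pastedCyclesLabel_of_adj_two I J K hv] at hI
  rcases pastedCyclesLabel_of_adj_five I J K hv' with h | h <;> rw [h] at hJK
  · exact inf_le_left.trans (sup_le hI hJK)
  · exact inf_le_right.trans (sup_le hI hJK)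

theorem IsSpline.sub_mem_sup_inf {R : Type*} [CommRing R] {I J K : Ideal R} {ρ : Fin 7 → R}
    (hρ : IsSpline pastedCycles (pastedCyclesLabel I J K) ρ) : ρ 2 - ρ 5 ∈ I ⊔ (J ⊓ K) := by
  have h21 : ρ 2 - ρ 1 ∈ I := by
    simpa [pastedCyclesLabel] using hρ 2 1 (by decide)
  have h10 : ρ 1 - ρ 0 ∈ I := by
    simpa [pastedCyclesLabel] using hρ 1 0 (by decide)
  have h04 : ρ 0 - ρ 4 ∈ J := by
    simpa [pastedCyclesLabel] using hρ 0 4 (by decide)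
  have h45 : ρ 4 - ρ 5 ∈ J := by
    simpa [pastedCyclesLabel] using hρ 4 5 (by decide)
  have h06 : ρ 0 - ρ 6 ∈ K := by
    simpa [pastedCyclesLabel] using hρ 0 6 (by decide)
  have h65 : ρ 6 - ρ 5 ∈ K := by
    simpa [pastedCyclesLabel] using hρ 6 5 (by decide)
  refine Submodule.mem_sup.2 ⟨ρ 2 - ρ 0, ?_, ρ 0 - ρ 5, ⟨?_, ?_⟩, by ring⟩
  · simpa using add_mem h21 h10
  · simpa using add_mem h04 h45
  · simpa using add_mem h06 h65

theorem inf_sup_le_of_UDP {R : Type*} [CommRing R] {I J K : Ideal R}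
    (h : UDP pastedCycles (pastedCyclesLabel I J K)) :
    (I ⊔ J) ⊓ (I ⊔ K) ≤ I ⊔ (J ⊓ K) := by
  intro x hx
  have hreach : pastedCycles.Reachable 2 5 :=
    ⟨.cons (v := 1) (by decide) (.cons (v := 0) (by decide)
      (.cons (v := 4) (by decide) (.cons (v := 5) (by decide) .nil)))⟩
  obtain ⟨ρ, hρ, rfl⟩ := h 2 5 hreach x (inf_sup_le_pathsInf I J K hx)
  exact hρ.sub_mem_sup_inf

theorem exists_mul_mem_span_singleton {R : Type*} [CommRing R]
    (hR : ∀ I J K : Ideal R, (I ⊔ J) ⊓ (I ⊔ K) ≤ I ⊔ (J ⊓ K)) (a b : R) :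
    ∃ c : R, c * b ∈ Ideal.span {a} ∧ (1 - c) * a ∈ Ideal.span {b} := by
  let L : DistribLattice (Ideal R) := DistribLattice.mk hR
  have hinf : ∀ I J K : Ideal R, I ⊓ (J ⊔ K) = (I ⊓ J) ⊔ (I ⊓ K) :=
    fun I J K => @inf_sup_left _ L I J K
  have ha : a ∈ Ideal.span {a} ⊓ (Ideal.span {b} ⊔ Ideal.span {a - b}) := by
    refine ⟨Ideal.mem_span_singleton_self a, Submodule.mem_sup.2 ⟨b, ?_, a - b, ?_, by ring⟩⟩ <;>
      exact Ideal.mem_span_singleton_self _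
  rw [hinf] at ha
  obtain ⟨t, ht, s, hs, hts⟩ := Submodule.mem_sup.1 ha
  obtain ⟨c, rfl⟩ := Ideal.mem_span_singleton'.1 hs.2
  refine ⟨c, ?_, ?_⟩
  · have := sub_mem (Ideal.mul_mem_left _ c (Ideal.mem_span_singleton_self a)) hs.1
    convert this using 1
    ring
  · have := sub_mem ht.2 (Ideal.mul_mem_left _ c (Ideal.mem_span_singleton_self b))
    convert this using 1
    linear_combination -hts

theorem exists_sum_eq_one_mul_mem_span_singleton {R : Type*} [CommRing R]
    (hR : ∀ a b : R, ∃ c : R, c * b ∈ Ideal.span {a} ∧ (1 - c) * a ∈ Ideal.span {b})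
    {S : Finset R} (hS : S.Nonempty) :
    ∃ c : R → R, ∑ i ∈ S, c i = 1 ∧ ∀ i ∈ S, ∀ j ∈ S, c i * j ∈ Ideal.span {i} := by
  classical
  induction hS using Finset.Nonempty.cons_induction with
  | singleton a => exact ⟨fun _ => 1, by simp, by simp⟩
  | cons b S hb _ ih =>
    obtain ⟨c, hc, hcm⟩ := ih
    choose d hd hd' using fun i => hR i b
    have hne : ∀ i ∈ S, i ≠ b := fun i hi h => hb (h ▸ hi)
    refine ⟨fun i => if i = b then ∑ k ∈ S, c k * (1 - d k) else c i * d i, ?_, ?_⟩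
    · rw [Finset.sum_cons, if_pos rfl, Finset.sum_congr rfl fun i hi => if_neg (hne i hi),
        ← Finset.sum_add_distrib]
      exact (Finset.sum_congr rfl fun i _ => by ring).trans hc
    · intro i hi j hj
      rw [Finset.mem_cons] at hi hj
      beta_reduce
      by_cases hib : i = b
      · subst hib
        rw [if_pos rfl]
        rcases hj with rfl | hj
        · exact Ideal.mul_mem_left _ _ (Ideal.mem_span_singleton_self _)
        · rw [Finset.sum_mul]
          refine sum_mem fun k hk => ?_
          obtain ⟨r, hr⟩ := Ideal.mem_span_singleton'.1 (hcm k hk j hj)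
          have := Ideal.mul_mem_left _ r (hd' k)
          convert this using 1
          linear_combination (d k - 1) * hr
      · have hiS := hi.resolve_left hib
        rw [if_neg hib]
        rcases hj with rfl | hj
        · rw [mul_assoc]
          exact Ideal.mul_mem_left _ _ (hd i)
        · rw [mul_right_comm]
          exact Ideal.mul_mem_right _ _ (hcm i hiS j hj)

theorem isPruferDomain_of_sum_eq_one {R : Type*} [CommRing R] [IsDomain R]
    (hR : ∀ S : Finset R, S.Nonempty →
      ∃ c : R → R, ∑ i ∈ S, c i = 1 ∧ ∀ i ∈ S, ∀ j ∈ S, c i * j ∈ Ideal.span {i}) :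
    IsPruferDomain R := by
  rintro I hI ⟨S, rfl⟩
  have hS : S.Nonempty := by
    rw [Finset.nonempty_iff_ne_empty]
    rintro rfl
    simp at hI
  obtain ⟨c, hc, hcm⟩ := hR S hS
  set I : Ideal R := Submodule.span R (S : Set R)
  have hcI : ∀ i ∈ S, ∀ x ∈ I, c i * x ∈ Ideal.span {i} := by
    intro i hi x hx
    induction hx using Submodule.span_induction with
    | mem x hx => exact hcm i hi x hx
    | zero => simp
    | add x y _ _ hx hy => rw [mul_add]; exact add_mem hx hy
    | smul r x _ hx => rw [smul_eq_mul, mul_left_comm]; exact Ideal.mul_mem_left _ _ hx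
  obtain ⟨x₀, hx₀, hx₀ne⟩ := Submodule.exists_mem_ne_zero_of_ne_bot hI
  have hI0 : (I : FractionalIdeal (nonZeroDivisors R) (FractionRing R)) ≠ 0 :=
    FractionalIdeal.coeIdeal_ne_zero.2 hI
  rw [← FractionalIdeal.mul_inv_cancel_iff_isUnit]
  refine le_antisymm (FractionalIdeal.mul_le.2 fun x hx y hy => ?_) ?_
  · rw [mul_comm]
    exact (FractionalIdeal.mem_inv_iff hI0).1 hy x hx
  rw [FractionalIdeal.one_le, ← map_one (algebraMap R (FractionRing R)), ← hc, map_sum,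
    ← FractionalIdeal.mem_coe]
  refine sum_mem fun i hi => ?_
  rw [FractionalIdeal.mem_coe]
  by_cases hi0 : i = 0
  · have h0 : c i = 0 := by
      have := hcI i hi x₀ hx₀
      rw [hi0, Ideal.span_singleton_eq_bot.2 rfl, Ideal.mem_bot] at this
      rw [hi0]
      exact (mul_eq_zero.1 this).resolve_right hx₀ne
    rw [h0, map_zero]
    exact FractionalIdeal.zero_mem _
  have hi0' : algebraMap R (FractionRing R) i ≠ 0 := by simpa using hi0
  have hdiv : algebraMap R (FractionRing R) (c i) =
      algebraMap R (FractionRing R) i *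
        (algebraMap R (FractionRing R) (c i) / algebraMap R (FractionRing R) i) := by
    field_simp
  rw [hdiv]
  refine FractionalIdeal.mul_mem_mul
    (FractionalIdeal.mem_coeIdeal_of_mem _ (Submodule.subset_span hi)) ?_
  rw [FractionalIdeal.mem_inv_iff hI0]
  intro y hy
  obtain ⟨x, hx, rfl⟩ := (FractionalIdeal.mem_coeIdeal _).1 hy
  obtain ⟨r, hr⟩ := Ideal.mem_span_singleton'.1 (hcI i hi x hx)
  rw [FractionalIdeal.mem_one_iff]
  refine ⟨r, ?_⟩
  rw [div_mul_eq_mul_div, eq_div_iff hi0', ← map_mul, ← map_mul, hr]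

theorem not_prufer_exists_not_UDP {R : Type*} [CommRing R] [IsDomain R]
    (h : ¬ IsPruferDomain R) :
    ∃ (G : SimpleGraph (Fin 7)) (α : Sym2 (Fin 7) → Ideal R), ¬ UDP G α := by
  by_contra! hUDP
  exact h <| isPruferDomain_of_sum_eq_one fun _ hS =>
    exists_sum_eq_one_mul_mem_span_singleton
      (exists_mul_mem_span_singleton fun _ _ _ => inf_sup_le_of_UDP (hUDP _ _)) hS
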